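/- Let E be a finite-dimensional real inner product space and F : E → ℝ∪{+∞} a closed convex function, three times continuously differentiable on its open convex effective domain dom F, with positive definite Hessian ∇²F(x) at every x ∈ dom F, and self-concordant with M = 2: |D³F(x)[u,u,u]| ≤ 2 (⟨∇²F(x)u,u⟩)^{3/2} for all x ∈ dom F, u ∈ E. Define the Newton decrement λ(x) = ⟨(∇²F(x))^{−1}∇F(x), ∇F(x)⟩^{1/2}. If λ(x) < 1 for some x ∈ dom F, then F attains its minimum on dom F at a unique point x* ∈ dom F. -/

import Mathlib

open scoped Classical RealInnerProductSpace

/-- The Hessian quadratic form `⟨∇²F(x)u, u⟩` of `F` at `x` in direction `u`. -/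
noncomputable def hessQ {E : Type*} [NormedAddCommGroup E] [NormedSpace ℝ E]
    (F : E → ℝ) (x u : E) : ℝ :=
  iteratedFDeriv ℝ 2 F x ![u, u]

/-- The Hessian bilinear form `⟨∇²F(x)u, v⟩`. -/
noncomputable def hessB {E : Type*} [NormedAddCommGroup E] [NormedSpace ℝ E]
    (F : E → ℝ) (x u v : E) : ℝ :=
  iteratedFDeriv ℝ 2 F x ![u, v]

/-- The third directional derivative `D³F(x)[u,u,u]`. -/
noncomputable def thirdD {E : Type*} [NormedAddCommGroup E] [NormedSpace ℝ E]
    (F : E → ℝ) (x u : E) : ℝ :=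
  iteratedFDeriv ℝ 3 F x ![u, u, u]

/-- A function with nonnegative derivative on `[0, 1]` is at least its initial value there. -/
lemma le_of_hasDerivAt_nonneg_Icc {f f' : ℝ → ℝ}
    (h : ∀ t ∈ Set.Icc (0 : ℝ) 1, HasDerivAt f (f' t) t)
    (h' : ∀ t ∈ Set.Icc (0 : ℝ) 1, 0 ≤ f' t) {t : ℝ} (ht : t ∈ Set.Icc (0 : ℝ) 1) :
    f 0 ≤ f t := by
  have hm : MonotoneOn f (Set.Icc 0 1) := by
    apply monotoneOn_of_deriv_nonneg (convex_Icc 0 1)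
    · exact fun t ht => (h t ht).continuousAt.continuousWithinAt
    · exact fun t ht =>
        (h t (interior_subset ht)).differentiableAt.differentiableWithinAt
    · intro t ht
      rw [(h t (interior_subset ht)).deriv]
      exact h' t (interior_subset ht)
  exact hm ⟨le_rfl, zero_le_one⟩ ht ht.1

/-- The lower bound `φ(1) ≥ φ(0) + φ'(0) + ω(√φ''(0))`, with `ω(r) = r - log (1 + r)`, for a
self-concordant function `φ` of one variable. -/
lemma selfConcordant_lower_bound_Icc {f f₁ f₂ f₃ : ℝ → ℝ}
    (h₀ : ∀ t ∈ Set.Icc (0 : ℝ) 1, HasDerivAt f (f₁ t) t)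
    (h₁ : ∀ t ∈ Set.Icc (0 : ℝ) 1, HasDerivAt f₁ (f₂ t) t)
    (h₂ : ∀ t ∈ Set.Icc (0 : ℝ) 1, HasDerivAt f₂ (f₃ t) t)
    (hpos : ∀ t ∈ Set.Icc (0 : ℝ) 1, 0 < f₂ t)
    (hsc : ∀ t ∈ Set.Icc (0 : ℝ) 1, |f₃ t| ≤ 2 * (f₂ t) ^ ((3 : ℝ) / 2)) :
    f 0 + f₁ 0 + (√(f₂ 0) - Real.log (1 + √(f₂ 0))) ≤ f 1 := by
  have h0mem : (0 : ℝ) ∈ Set.Icc (0 : ℝ) 1 := ⟨le_rfl, zero_le_one⟩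
  have h1mem : (1 : ℝ) ∈ Set.Icc (0 : ℝ) 1 := ⟨zero_le_one, le_rfl⟩
  set a := √(f₂ 0) with ha
  have hapos : 0 < a := Real.sqrt_pos.2 (hpos 0 h0mem)
  have hden : ∀ t ∈ Set.Icc (0 : ℝ) 1, 0 < 1 + t * a := fun t ht => by
    have := mul_nonneg ht.1 hapos.le
    linarith
  have hlin : ∀ t : ℝ, HasDerivAt (fun t : ℝ => 1 + t * a) a t := fun t => by
    simpa using ((hasDerivAt_id t).mul_const a).const_add 1
  have hf₂ : ∀ t ∈ Set.Icc (0 : ℝ) 1, a ^ 2 / (1 + t * a) ^ 2 ≤ f₂ t := by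
    intro t ht
    have key := le_of_hasDerivAt_nonneg_Icc (f := fun t => t - (√(f₂ t))⁻¹)
      (f' := fun t => 1 - -(f₃ t / (2 * √(f₂ t))) / √(f₂ t) ^ 2) (fun s hs =>
        (hasDerivAt_id s).sub (((h₂ s hs).sqrt (hpos s hs).ne').inv
          (Real.sqrt_pos.2 (hpos s hs)).ne')) (fun s hs => ?_) ht
    · have hs : 0 < √(f₂ t) := Real.sqrt_pos.2 (hpos t ht)
      have hinv : (√(f₂ t))⁻¹ ≤ (1 + t * a) / a := by
        have : (1 + t * a) / a = a⁻¹ + t := by field_simp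
        simp only [← ha] at key
        linarith
      have h := hden t ht
      have h' : a / (1 + t * a) ≤ √(f₂ t) := by
        rw [← inv_div]
        exact inv_le_of_inv_le₀ hs hinv
      calc a ^ 2 / (1 + t * a) ^ 2 = (a / (1 + t * a)) ^ 2 := by rw [div_pow]
        _ ≤ √(f₂ t) ^ 2 := by gcongr
        _ = f₂ t := Real.sq_sqrt (hpos t ht).le
    · have hp := hpos s hs
      have hr : 0 < √(f₂ s) := Real.sqrt_pos.2 hp
      have hb := neg_le_of_abs_le (hsc s hs)
      have hpow : (f₂ s) ^ ((3 : ℝ) / 2) = √(f₂ s) ^ 3 := by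
        rw [Real.sqrt_eq_rpow, ← Real.rpow_natCast, ← Real.rpow_mul hp.le]
        norm_num
      rw [hpow] at hb
      have : 1 - -(f₃ s / (2 * √(f₂ s))) / √(f₂ s) ^ 2
          = (2 * √(f₂ s) ^ 3 + f₃ s) / (2 * √(f₂ s) ^ 3) := by
        field_simp
        ring
      rw [this]
      apply div_nonneg _ (by positivity)
      linarith
  have hf₁ : ∀ t ∈ Set.Icc (0 : ℝ) 1, f₁ 0 + a ≤ f₁ t + a / (1 + t * a) := by
    intro t ht
    have key := le_of_hasDerivAt_nonneg_Icc (f := fun t => f₁ t + a * (1 + t * a)⁻¹)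
      (f' := fun t => f₂ t + a * (-a / (1 + t * a) ^ 2)) (fun s hs =>
        (h₁ s hs).add (((hlin s).inv (hden s hs).ne').const_mul a)) (fun s hs => ?_) ht
    · simpa [div_eq_mul_inv] using key
    · have := hf₂ s hs
      have e : a * (-a / (1 + s * a) ^ 2) = -(a ^ 2 / (1 + s * a) ^ 2) := by ring
      rw [e]
      linarith
  have key := le_of_hasDerivAt_nonneg_Icc
    (f := fun t => f t - t * (f₁ 0 + a) + Real.log (1 + t * a))
    (f' := fun t => f₁ t - 1 * (f₁ 0 + a) + a / (1 + t * a)) (fun s hs =>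
      ((h₀ s hs).sub ((hasDerivAt_id s).mul_const _)).add ((hlin s).log (hden s hs).ne'))
    (fun s hs => by
      have := hf₁ s hs
      linarith) h1mem
  simp only [zero_mul, one_mul, sub_zero, add_zero, Real.log_one] at key
  linarith

section Derivatives

variable {E : Type*} [NormedAddCommGroup E] [NormedSpace ℝ E]

lemma hasDerivAt_iteratedFDeriv_line {F : E → ℝ} {n : WithTop ℕ∞} {k : ℕ} {x u : E} {t : ℝ}
    (hF : ContDiffAt ℝ n F (x + t • u)) (hk : (k : WithTop ℕ∞) + 1 ≤ n) :
    HasDerivAt (fun s : ℝ => iteratedFDeriv ℝ k F (x + s • u) fun _ => u)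
      (iteratedFDeriv ℝ (k + 1) F (x + t • u) fun _ => u) t := by
  have hd : DifferentiableAt ℝ (iteratedFDeriv ℝ k F) (x + t • u) :=
    (hF.iteratedFDeriv_right (m := 1) (by rwa [add_comm])).differentiableAt one_ne_zero
  have hl : HasDerivAt (fun s : ℝ => x + s • u) u t := by
    simpa using ((hasDerivAt_id t).smul_const u).const_add x
  have hc := hd.hasFDerivAt.comp_hasDerivAt t hl
  rw [iteratedFDeriv_succ_apply_left]
  exact ((ContinuousMultilinearMap.apply ℝ (fun _ : Fin k => E) ℝ
    fun _ => u).hasFDerivAt.comp_hasDerivAt t hc)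

lemma hessB_eq_fderiv_fderiv (F : E → ℝ) (x u v : E) :
    hessB F x u v = fderiv ℝ (fderiv ℝ F) x u v := by
  simp [hessB, iteratedFDeriv_two_apply]

lemma hessQ_eq_fderiv_fderiv (F : E → ℝ) (x u : E) :
    hessQ F x u = fderiv ℝ (fderiv ℝ F) x u u :=
  hessB_eq_fderiv_fderiv F x u u

/-- The lower bound `F y ≥ F x + ⟨∇F(x), y - x⟩ + ω(‖y - x‖_x)`, with `ω(r) = r - log (1 + r)`, for
a self-concordant function. -/
lemma selfConcordant_lower_bound {D : Set E} (hDo : IsOpen D) (hDc : Convex ℝ D) {F : E → ℝ}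
    (hF : ContDiffOn ℝ 3 F D)
    (hpos : ∀ x ∈ D, ∀ u : E, u ≠ 0 → 0 < hessQ F x u)
    (hsc : ∀ x ∈ D, ∀ u : E, |thirdD F x u| ≤ 2 * (hessQ F x u) ^ ((3 : ℝ) / 2))
    {x y : E} (hx : x ∈ D) (hy : y ∈ D) :
    F x + fderiv ℝ F x (y - x) +
      (√(hessQ F x (y - x)) - Real.log (1 + √(hessQ F x (y - x)))) ≤ F y := by
  rcases eq_or_ne y x with rfl | hne
  · simp [hessQ_eq_fderiv_fderiv]
  set u := y - x with hu
  have hu0 : u ≠ 0 := sub_ne_zero.2 hne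
  have hmem : ∀ t ∈ Set.Icc (0 : ℝ) 1, x + t • u ∈ D := fun t ht =>
    hDc.add_smul_sub_mem hx hy ht
  have hcd : ∀ t ∈ Set.Icc (0 : ℝ) 1, ContDiffAt ℝ 3 F (x + t • u) := fun t ht =>
    hF.contDiffAt (hDo.mem_nhds (hmem t ht))
  have hvec2 : (![u, u] : Fin 2 → E) = fun _ => u := by ext i; fin_cases i <;> rfl
  have hvec3 : (![u, u, u] : Fin 3 → E) = fun _ => u := by ext i; fin_cases i <;> rfl
  have key := selfConcordant_lower_bound_Icc
    (f := fun s => iteratedFDeriv ℝ 0 F (x + s • u) fun _ => u)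
    (f₁ := fun s => iteratedFDeriv ℝ 1 F (x + s • u) fun _ => u)
    (f₂ := fun s => iteratedFDeriv ℝ 2 F (x + s • u) fun _ => u)
    (f₃ := fun s => iteratedFDeriv ℝ 3 F (x + s • u) fun _ => u)
    (fun t ht => hasDerivAt_iteratedFDeriv_line (hcd t ht) (by norm_num))
    (fun t ht => hasDerivAt_iteratedFDeriv_line (hcd t ht) (by norm_num))
    (fun t ht => hasDerivAt_iteratedFDeriv_line (hcd t ht) (by norm_num))
    (fun t ht => by simpa only [hessQ, hvec2] using hpos _ (hmem t ht) u hu0)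
    (fun t ht => by
      have h := hsc _ (hmem t ht) u
      rwa [thirdD, hvec3, hessQ, hvec2] at h)
  rw [hessQ, hvec2]
  simpa [hu] using key

/-- Cauchy–Schwarz inequality for the Hessian form at a point. -/
lemma hessB_sq_le {F : E → ℝ} {x : E} (hF : ContDiffAt ℝ 2 F x)
    (hpos : ∀ u : E, u ≠ 0 → 0 < hessQ F x u) (p v : E) :
    hessB F x p v ^ 2 ≤ hessQ F x p * hessQ F x v := by
  have hsymm : fderiv ℝ (fderiv ℝ F) x v p = fderiv ℝ (fderiv ℝ F) x p v :=
    hF.isSymmSndFDerivAt (by simp) v p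
  have hd := discrim_le_zero (a := hessQ F x p) (b := 2 * hessB F x p v) (c := hessQ F x v)
    fun s => by
      have h : 0 ≤ hessQ F x (s • p + v) := by
        rcases eq_or_ne (s • p + v) 0 with h | h
        · simp [h, hessQ_eq_fderiv_fderiv]
        · exact (hpos _ h).le
      simp only [hessQ_eq_fderiv_fderiv, hessB_eq_fderiv_fderiv, map_add, map_smul,
        add_apply, smul_apply, smul_eq_mul, hsymm] at h ⊢
      linarith
  rw [discrim] at hd
  linarith

/-- Sublevel sets of a positive definite Hessian form are bounded. -/
lemma isBounded_hessQ_sub_le [FiniteDimensional ℝ E] {F : E → ℝ} {x : E}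
    (hpos : ∀ u : E, u ≠ 0 → 0 < hessQ F x u) (R : ℝ) :
    Bornology.IsBounded {y | hessQ F x (y - x) ≤ R} := by
  have hcont : Continuous fun u => hessQ F x u := by
    simp only [hessQ_eq_fderiv_fderiv]
    fun_prop
  obtain ⟨m, hm, hmle⟩ : ∃ m > 0, ∀ v : E, ‖v‖ = 1 → m ≤ hessQ F x v := by
    rcases (Metric.sphere (0 : E) 1).eq_empty_or_nonempty with h | h
    · refine ⟨1, one_pos, fun v hv => ?_⟩
      have : v ∈ Metric.sphere (0 : E) 1 := by simpa using hv
      simp [h] at this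
    · obtain ⟨w, hw, hmin⟩ := (isCompact_sphere (0 : E) 1).exists_isMinOn h hcont.continuousOn
      refine ⟨hessQ F x w, hpos w (ne_zero_of_mem_unit_sphere ⟨w, hw⟩), fun v hv => ?_⟩
      exact hmin (by simpa using hv)
  have hquad : ∀ v : E, m * ‖v‖ ^ 2 ≤ hessQ F x v := fun v => by
    rcases eq_or_ne v 0 with rfl | hv
    · simp [hessQ_eq_fderiv_fderiv]
    · have h := hmle (‖v‖⁻¹ • v) (by
        rw [norm_smul, norm_inv, norm_norm, inv_mul_cancel₀ (norm_ne_zero_iff.2 hv)])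
      have hn : 0 < ‖v‖ := norm_pos_iff.2 hv
      simp only [hessQ_eq_fderiv_fderiv, map_smul, smul_apply, smul_eq_mul] at h ⊢
      have := mul_le_mul_of_nonneg_left h (sq_nonneg ‖v‖)
      field_simp at this
      linarith
  rw [Metric.isBounded_iff_subset_closedBall x]
  refine ⟨√(R / m), fun y hy => ?_⟩
  rw [Metric.mem_closedBall, dist_eq_norm]
  apply Real.le_sqrt_of_sq_le
  rw [le_div_iff₀' hm]
  exact (hquad _).trans hy

end Derivatives

/-- **Existence of the minimizer of a self-concordant function.** If the Newton
decrement `λ(x) = ⟨(∇²F(x))⁻¹∇F(x), ∇F(x)⟩^{1/2}` satisfies `λ(x) < 1` at some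
`x ∈ dom F` (here `p` is the Newton direction, i.e. `∇²F(x)p = ∇F(x)`, so that
`λ(x) = ⟨∇F(x), p⟩^{1/2}`), then `F` attains its minimum over `dom F` at a unique
point. -/
theorem sc_minimizer_exists {E : Type*} [NormedAddCommGroup E]
    [InnerProductSpace ℝ E] [FiniteDimensional ℝ E]
    (D : Set E) (hDo : IsOpen D) (hDc : Convex ℝ D)
    (F : E → ℝ)
    (hclosed : LowerSemicontinuous (fun x => if x ∈ D then (F x : EReal) else ⊤))
    (hconv : ConvexOn ℝ D F)
    (hF : ContDiffOn ℝ 3 F D)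
    (hpos : ∀ x ∈ D, ∀ u : E, u ≠ 0 → 0 < hessQ F x u)
    (hsc : ∀ x ∈ D, ∀ u : E, |thirdD F x u| ≤ 2 * (hessQ F x u) ^ ((3 : ℝ) / 2))
    (x : E) (hx : x ∈ D) (p : E)
    (hp : ∀ v : E, hessB F x p v = ⟪gradient F x, v⟫)
    (hlam : Real.sqrt ⟪gradient F x, p⟫ < 1) :
    ∃ xstar ∈ D, (∀ y ∈ D, F xstar ≤ F y) ∧
      ∀ z ∈ D, (∀ y ∈ D, F z ≤ F y) → z = xstar := by
  have hDx := hDo.mem_nhds hx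
  have hgrad : ∀ v : E, hessB F x p v = fderiv ℝ F x v := fun v => by
    rw [hp, inner_gradient_left]
  have hQp : hessQ F x p = ⟪gradient F x, p⟫ := hp p
  set l := √(hessQ F x p) with hl
  have hl1 : l < 1 := by rwa [hl, hQp]
  -- The sublevel set of `x` is bounded in the local norm at `x`.
  set c := (1 - l) / 2 with hc
  have hc0 : 0 < c := by rw [hc]; linarith
  set R := (c - 1 - Real.log c) / c with hR
  have hbound : ∀ y ∈ D, F y ≤ F x → hessQ F x (y - x) ≤ R ^ 2 := by
    intro y hy hyx
    have hlow := selfConcordant_lower_bound hDo hDc hF hpos hsc hx hy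
    set r := √(hessQ F x (y - x)) with hr
    have hr0 : 0 ≤ r := Real.sqrt_nonneg _
    have hcs : |fderiv ℝ F x (y - x)| ≤ l * r := by
      have := hessB_sq_le ((hF.contDiffAt hDx).of_le (by norm_num)) (hpos x hx) p (y - x)
      rw [hgrad] at this
      have hp0 : 0 ≤ hessQ F x p := by
        rcases eq_or_ne p 0 with rfl | h
        · simp [hessQ_eq_fderiv_fderiv]
        · exact (hpos x hx p h).le
      rw [hl, hr, ← Real.sqrt_mul hp0]
      exact Real.abs_le_sqrt this
    have hlog : Real.log (1 + r) ≤ c * (1 + r) - 1 - Real.log c := by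
      have := Real.log_le_sub_one_of_pos (mul_pos hc0 (by linarith : 0 < 1 + r))
      rw [Real.log_mul hc0.ne' (by linarith)] at this
      linarith
    have hle : r ≤ R := by
      rw [hR, le_div_iff₀ hc0]
      have := neg_le_of_abs_le hcs
      have hl' : l = 1 - 2 * c := by rw [hc]; ring
      rw [hl'] at this
      linarith
    exact (Real.sqrt_le_iff.1 hle).2
  set G : E → EReal := fun x => if x ∈ D then (F x : EReal) else ⊤ with hG
  have hGD : ∀ y ∈ D, G y = F y := fun y hy => if_pos hy
  set K := G ⁻¹' Set.Iic (F x : EReal) with hK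
  have hKD : ∀ y ∈ K, y ∈ D ∧ F y ≤ F x := by
    intro y hy
    by_cases h : y ∈ D
    · refine ⟨h, ?_⟩
      simpa [hK, hGD y h] using hy
    · simp [hK, hG, h] at hy
  have hKc : IsCompact K := by
    refine Metric.isCompact_of_isClosed_isBounded (hclosed.isClosed_preimage _)
      ((isBounded_hessQ_sub_le (hpos x hx) (R ^ 2)).subset fun y hy => ?_)
    exact hbound y (hKD y hy).1 (hKD y hy).2
  have hxK : x ∈ K := by simp [hK, hGD x hx]
  obtain ⟨z, hzK, hz⟩ :=
    LowerSemicontinuousOn.exists_isMinOn ⟨x, hxK⟩ hKc (hclosed.lowerSemicontinuousOn K)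
  have hzD := (hKD z hzK).1
  have hmin : ∀ y ∈ D, F z ≤ F y := by
    intro y hy
    rcases le_total (F y) (F x) with h | h
    · have hyK : y ∈ K := by simpa [hK, hGD y hy] using h
      have := hz hyK
      simpa [hGD y hy, hGD z hzD] using this
    · exact (hKD z hzK).2.trans h
  refine ⟨z, hzD, hmin, fun w hw hwmin => ?_⟩
  by_contra hne
  have hlow := selfConcordant_lower_bound hDo hDc hF hpos hsc hzD hw
  have hloc : IsLocalMin F z := by
    filter_upwards [hDo.mem_nhds hzD] with y hy using hmin y hy
  have hr0 : 0 < √(hessQ F z (w - z)) := Real.sqrt_pos.2 (hpos z hzD _ (sub_ne_zero.2 hne))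
  have hlog := Real.log_lt_sub_one_of_pos (x := 1 + √(hessQ F z (w - z)))
    (by linarith) (by linarith)
  rw [hloc.fderiv_eq_zero] at hlow
  have := hwmin z hzD
  simp only [zero_apply] at hlow
  linarith
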